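/- arXiv:1603.07181 — 2 statements merged into one kernel-verified Lean document; each statement's English description precedes it below -/
import Mathlib

section
/- Let X, Y be nonempty finite sets, L a linear subspace of real-valued functions on X × Y, p a strictly positive probability distribution on X, k ∈ K(X;Y) a channel, and k₀ ∈ K(X;Y) a strictly positive channel. Let k' be the unique channel in the intersection of the mixture family M_p(k,L) with the closure of the exponential family E(k₀,L) (the rI-projection of k onto that closure). Then for every channel m in the closure of E(k₀,L) the Pythagorean identity D_p(k||m) = D_p(k||k') + D_p(k'||m) holds. -/
open scoped ENNReal BigOperators

/-- `k : X × Y → ℝ` is a channel (Markov kernel) from `X` to `Y`: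
nonnegative entries, rows summing to one. -/
def IsChannel {X Y : Type} [Fintype Y] (k : X × Y → ℝ) : Prop :=
  (∀ z, 0 ≤ k z) ∧ ∀ x : X, ∑ y : Y, k (x, y) = 1

/-- Channel divergence `D_p(k‖m)`, valued in `[0,∞]`, with the conventions
`0·log(0/t) = 0` and `t·log(t/0) = ∞` for `t > 0`. -/
noncomputable def chanDiv {X Y : Type} [Fintype X] [Fintype Y]
    (p : X → ℝ) (k m : X × Y → ℝ) : ℝ≥0∞ :=
  if ∀ z : X × Y, p z.1 * k z ≠ 0 → m z ≠ 0 then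
    ENNReal.ofReal (∑ z : X × Y, p z.1 * k z * Real.log (k z / m z))
  else ⊤

/-- The mixture family `M_p(k, L)` generated by the channel `k` and the linear
subspace `L` of functions on `X × Y`, with respect to the input distribution `p`. -/
def mixFam {X Y : Type} [Fintype X] [Fintype Y] (p : X → ℝ) (k : X × Y → ℝ)
    (L : Submodule ℝ (X × Y → ℝ)) : Set (X × Y → ℝ) :=
  {m | IsChannel m ∧
    ∀ l ∈ L, ∑ z : X × Y, p z.1 * m z * l z = ∑ z : X × Y, p z.1 * k z * l z}

/-- The exponential family `E(k₀, L)` generated by the reference channel `k₀` and the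
linear subspace `L` of functions on `X × Y`. -/
noncomputable def expFam {X Y : Type} [Fintype Y] (k₀ : X × Y → ℝ)
    (L : Submodule ℝ (X × Y → ℝ)) : Set (X × Y → ℝ) :=
  {m | ∃ l ∈ L, m = fun z : X × Y =>
    Real.exp (l z) * k₀ z / ∑ y : Y, Real.exp (l (z.1, y)) * k₀ (z.1, y)}

open Filter Topology

/-- Information inequality: the divergence sum of two channels is nonnegative. -/
theorem divergence_sum_nonneg {X Y : Type} [Fintype X] [Fintype Y]
    {p : X → ℝ} (hp : ∀ x, 0 ≤ p x) {k m : X × Y → ℝ} (hk : IsChannel k) (hm : IsChannel m)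
    (hac : ∀ z : X × Y, p z.1 * k z ≠ 0 → m z ≠ 0) :
    0 ≤ ∑ z : X × Y, p z.1 * k z * Real.log (k z / m z) := by
  have h0 : ∑ z : X × Y, p z.1 * (k z - m z) = 0 := by
    simp [Fintype.sum_prod_type, ← Finset.mul_sum, Finset.sum_sub_distrib, hk.2, hm.2]
  rw [← h0]
  refine Finset.sum_le_sum fun z _ => ?_
  by_cases hz : p z.1 * k z = 0
  · rw [hz, mul_sub, hz]
    have := mul_nonneg (hp z.1) (hm.1 z)
    linarith
  · have hkz : 0 < k z := (hk.1 z).lt_of_ne' (right_ne_zero_of_mul hz)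
    have hmz : 0 < m z := (hm.1 z).lt_of_ne' (hac z hz)
    have hlog := Real.one_sub_inv_le_log_of_pos (div_pos hkz hmz)
    calc p z.1 * (k z - m z) = p z.1 * k z * (1 - (k z / m z)⁻¹) := by
          field_simp
      _ ≤ _ := mul_le_mul_of_nonneg_left hlog (mul_nonneg (hp _) hkz.le)

/-- Splitting the divergence sum into an entropy part and a cross-entropy part. -/
theorem divergence_sum_eq {X Y : Type} [Fintype X] [Fintype Y]
    {p : X → ℝ} {k m : X × Y → ℝ} (hac : ∀ z : X × Y, p z.1 * k z ≠ 0 → m z ≠ 0) :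
    ∑ z : X × Y, p z.1 * k z * Real.log (k z / m z) =
      ∑ z : X × Y, p z.1 * k z * Real.log (k z) -
        ∑ z : X × Y, p z.1 * k z * Real.log (m z) := by
  rw [← Finset.sum_sub_distrib]
  refine Finset.sum_congr rfl fun z _ => ?_
  by_cases hz : p z.1 * k z = 0
  · simp [hz]
  · rw [Real.log_div (right_ne_zero_of_mul hz) (hac z hz), mul_sub]

theorem isChannel_of_mem_expFam {X Y : Type} [Fintype Y] [Nonempty Y]
    {k₀ : X × Y → ℝ} (hk₀ : ∀ z, 0 < k₀ z) {L : Submodule ℝ (X × Y → ℝ)}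
    {m : X × Y → ℝ} (hm : m ∈ expFam k₀ L) : IsChannel m ∧ ∀ z, 0 < m z := by
  obtain ⟨l, -, rfl⟩ := hm
  have hZ (x : X) : 0 < ∑ y : Y, Real.exp (l (x, y)) * k₀ (x, y) :=
    Finset.sum_pos (fun y _ => mul_pos (Real.exp_pos _) (hk₀ _)) Finset.univ_nonempty
  have hpos (z : X × Y) :
      0 < Real.exp (l z) * k₀ z / ∑ y : Y, Real.exp (l (z.1, y)) * k₀ (z.1, y) :=
    div_pos (mul_pos (Real.exp_pos _) (hk₀ _)) (hZ _)
  refine ⟨⟨fun z => (hpos z).le, fun x => ?_⟩, hpos⟩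
  simp only [← Finset.sum_div]
  exact div_self (hZ x).ne'

theorem IsChannel.le_one {X Y : Type} [Fintype Y] {k : X × Y → ℝ} (hk : IsChannel k)
    (z : X × Y) : k z ≤ 1 := by
  rw [← hk.2 z.1]
  exact Finset.single_le_sum (f := fun y => k (z.1, y)) (fun y _ => hk.1 _) (Finset.mem_univ z.2)

theorem isClosed_setOf_isChannel {X Y : Type} [Fintype Y] :
    IsClosed {k : X × Y → ℝ | IsChannel k} := by
  simp only [IsChannel, Set.ofPred_and, Set.ofPred_forall]
  exact (isClosed_iInter fun z => isClosed_le continuous_const (continuous_apply z)).inter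
    (isClosed_iInter fun x => isClosed_eq (by fun_prop) continuous_const)

/-- On the exponential family, the cross entropies from two members of the same mixture family
differ by a constant. -/
theorem sum_mul_log_eq_of_mem_expFam {X Y : Type} [Fintype X] [Fintype Y] [Nonempty Y]
    {L : Submodule ℝ (X × Y → ℝ)} {p : X → ℝ} {k k' k₀ : X × Y → ℝ} (hk : IsChannel k)
    (hk₀ : ∀ z, 0 < k₀ z) (hk' : k' ∈ mixFam p k L) {m : X × Y → ℝ} (hm : m ∈ expFam k₀ L) :
    ∑ z : X × Y, p z.1 * k z * Real.log (m z) =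
      ∑ z : X × Y, p z.1 * k' z * Real.log (m z) +
        (∑ z : X × Y, p z.1 * k z * Real.log (k₀ z) -
          ∑ z : X × Y, p z.1 * k' z * Real.log (k₀ z)) := by
  obtain ⟨l, hl, rfl⟩ := hm
  set Z : X → ℝ := fun x => ∑ y : Y, Real.exp (l (x, y)) * k₀ (x, y)
  have hZ (x : X) : 0 < Z x :=
    Finset.sum_pos (fun y _ => mul_pos (Real.exp_pos _) (hk₀ _)) Finset.univ_nonempty
  have key {n : X × Y → ℝ} (hn : IsChannel n) :
      ∑ z : X × Y, p z.1 * n z * Real.log (Real.exp (l z) * k₀ z / Z z.1) =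
        ∑ z : X × Y, p z.1 * n z * l z + ∑ z : X × Y, p z.1 * n z * Real.log (k₀ z) -
          ∑ x, p x * Real.log (Z x) := by
    have hlogZ : ∑ x, p x * Real.log (Z x) =
        ∑ z : X × Y, p z.1 * n z * Real.log (Z z.1) := by
      rw [Fintype.sum_prod_type]
      refine Finset.sum_congr rfl fun x _ => ?_
      simp only [← Finset.sum_mul, ← Finset.mul_sum, hn.2, mul_one]
    rw [hlogZ, ← Finset.sum_add_distrib, ← Finset.sum_sub_distrib]
    refine Finset.sum_congr rfl fun z _ => ?_
    rw [Real.log_div (mul_pos (Real.exp_pos _) (hk₀ z)).ne' (hZ _).ne',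
      Real.log_mul (Real.exp_pos _).ne' (hk₀ z).ne', Real.log_exp]
    ring
  change ∑ z : X × Y, p z.1 * k z * Real.log (Real.exp (l z) * k₀ z / Z z.1) =
    ∑ z : X × Y, p z.1 * k' z * Real.log (Real.exp (l z) * k₀ z / Z z.1) + _
  rw [key hk, key hk'.1, hk'.2 l hl]
  ring

theorem tendsto_sum_mul_log {ι : Type*} [Fintype ι] {w m : ι → ℝ} {u : ℕ → ι → ℝ}
    (hu : Tendsto u atTop (𝓝 m)) (hac : ∀ z, w z ≠ 0 → m z ≠ 0) :
    Tendsto (fun i => ∑ z, w z * Real.log (u i z)) atTop (𝓝 (∑ z, w z * Real.log (m z))) := by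
  refine tendsto_finsetSum _ fun z _ => ?_
  by_cases hz : w z = 0
  · simp [hz]
  · exact ((tendsto_pi_nhds.1 hu z).log (hac z hz)).const_mul _

/-- If weighted log-sums along a convergent sequence stay bounded below, the limit does not vanish
on the support of the weight. -/
theorem limit_ne_zero_of_le_sum_mul_log {ι : Type*} [Fintype ι] {w m : ι → ℝ} {u : ℕ → ι → ℝ}
    (hw : ∀ z, 0 ≤ w z) (hu : Tendsto u atTop (𝓝 m)) (hpos : ∀ i z, 0 < u i z)
    (hle : ∀ i z, u i z ≤ 1) {C : ℝ} (hC : ∀ᶠ i in atTop, C ≤ ∑ z, w z * Real.log (u i z))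
    {z : ι} (hz : w z ≠ 0) : m z ≠ 0 := by
  have hwz : 0 < w z := (hw z).lt_of_ne' hz
  refine ((Real.exp_pos (C / w z)).trans_le
    (ge_of_tendsto (tendsto_pi_nhds.1 hu z) ?_)).ne'
  filter_upwards [hC] with i hi
  rw [← Real.le_log_iff_exp_le (hpos i z), div_le_iff₀' hwz]
  refine hi.trans ?_
  rw [← neg_le_neg_iff, ← Finset.sum_neg_distrib]
  exact Finset.single_le_sum (f := fun z => -(w z * Real.log (u i z)))
    (fun y _ => neg_nonneg.2 (mul_nonpos_of_nonneg_of_nonpos (hw y)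
      (Real.log_nonpos (hpos i y).le (hle i y)))) (Finset.mem_univ z)

/-- A constant difference of weighted log-sums on a set of positive functions bounded by one
passes to the closure, together with the inclusion of supports. -/
theorem sum_mul_log_eq_of_mem_closure {ι : Type*} [Fintype ι] {w w' : ι → ℝ} {E : Set (ι → ℝ)}
    {c : ℝ} (hw : ∀ z, 0 ≤ w z) (hpos : ∀ m ∈ E, ∀ z, 0 < m z) (hle : ∀ m ∈ E, ∀ z, m z ≤ 1)
    (hE : ∀ m ∈ E, ∑ z, w z * Real.log (m z) = ∑ z, w' z * Real.log (m z) + c)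
    {m : ι → ℝ} (hm : m ∈ closure E) (hac : ∀ z, w' z ≠ 0 → m z ≠ 0) :
    (∀ z, w z ≠ 0 → m z ≠ 0) ∧
      ∑ z, w z * Real.log (m z) = ∑ z, w' z * Real.log (m z) + c := by
  obtain ⟨u, huE, hu⟩ := mem_closure_iff_seq_limit.1 hm
  have hlim : Tendsto (fun i => ∑ z, w z * Real.log (u i z)) atTop
      (𝓝 (∑ z, w' z * Real.log (m z) + c)) := by
    simp_rw [fun i => hE (u i) (huE i)]
    exact (tendsto_sum_mul_log hu hac).add_const c
  have hac' : ∀ z, w z ≠ 0 → m z ≠ 0 := fun z hz =>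
    limit_ne_zero_of_le_sum_mul_log hw hu (fun i => hpos _ (huE i)) (fun i => hle _ (huE i))
      (hlim.eventually_const_le (sub_one_lt _)) hz
  exact ⟨hac', tendsto_nhds_unique (tendsto_sum_mul_log hu hac') hlim⟩

/-- **Pythagorean identity (exponential side).** If `k'` is the channel in the
intersection of `M_p(k,L)` with the closure of `E(k₀,L)` (the rI-projection of `k`),
then `D_p(k‖m) = D_p(k‖k') + D_p(k'‖m)` for every `m` in the closure of `E(k₀,L)`. -/
theorem pythagorean_expFam
    {X Y : Type} [Fintype X] [Fintype Y] [Nonempty X] [Nonempty Y]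
    (L : Submodule ℝ (X × Y → ℝ))
    (p : X → ℝ) (hp_pos : ∀ x, 0 < p x) (hp_sum : ∑ x, p x = 1)
    (k : X × Y → ℝ) (hk : IsChannel k)
    (k₀ : X × Y → ℝ) (hk₀ : IsChannel k₀) (hk₀_pos : ∀ z, 0 < k₀ z)
    (k' : X × Y → ℝ) (hk'M : k' ∈ mixFam p k L) (hk'E : k' ∈ closure (expFam k₀ L)) :
    ∀ m ∈ closure (expFam k₀ L),
      chanDiv p k m = chanDiv p k k' + chanDiv p k' m := by
  intro m hm
  have hp (x : X) : 0 ≤ p x := (hp_pos x).le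
  have hk' : IsChannel k' := hk'M.1
  have hchan {n : X × Y → ℝ} (hn : n ∈ closure (expFam k₀ L)) : IsChannel n :=
    closure_minimal (fun n hn => (isChannel_of_mem_expFam hk₀_pos hn).1)
      isClosed_setOf_isChannel hn
  have hpos : ∀ n ∈ expFam k₀ L, ∀ z, 0 < n z := fun n hn =>
    (isChannel_of_mem_expFam hk₀_pos hn).2
  have hle : ∀ n ∈ expFam k₀ L, ∀ z, n z ≤ 1 := fun n hn =>
    (isChannel_of_mem_expFam hk₀_pos hn).1.le_one
  have hE := fun n (hn : n ∈ expFam k₀ L) => sum_mul_log_eq_of_mem_expFam hk hk₀_pos hk'M hn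
  have hw : ∀ z : X × Y, 0 ≤ p z.1 * k z := fun z => mul_nonneg (hp _) (hk.1 z)
  have hw' : ∀ z : X × Y, 0 ≤ p z.1 * k' z := fun z => mul_nonneg (hp _) (hk'.1 z)
  obtain ⟨hkk', hsum'⟩ := sum_mul_log_eq_of_mem_closure hw hpos hle hE hk'E
    fun z hz => right_ne_zero_of_mul hz
  by_cases hk'm : ∀ z : X × Y, p z.1 * k' z ≠ 0 → m z ≠ 0
  · obtain ⟨hkm, hsum⟩ := sum_mul_log_eq_of_mem_closure hw hpos hle hE hm hk'm
    rw [chanDiv, chanDiv, chanDiv, if_pos hkm, if_pos hkk', if_pos hk'm,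
      ← ENNReal.ofReal_add (divergence_sum_nonneg hp hk hk' hkk')
        (divergence_sum_nonneg hp hk' (hchan hm) hk'm),
      divergence_sum_eq hkm, divergence_sum_eq hkk', divergence_sum_eq hk'm]
    congr 1
    linarith
  · have hkm : ¬ ∀ z : X × Y, p z.1 * k z ≠ 0 → m z ≠ 0 := fun hkm =>
      hk'm (sum_mul_log_eq_of_mem_closure hw' hpos hle
        (fun n hn => eq_add_neg_of_add_eq (hE n hn).symm) hm hkm).1
    rw [chanDiv, if_neg hkm, chanDiv.eq_def p k' m, if_neg hk'm, add_top]
end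

section
/- Let X, Y be nonempty finite sets, L a linear subspace of real-valued functions on X × Y, p a strictly positive probability distribution on X, k ∈ K(X;Y) a channel, and k₀ ∈ K(X;Y) a strictly positive channel. Let k' = (x,y) ↦ e^{l(x,y)} k₀(x;y)/Z(x) with l ∈ L and Z(x) = ∑_y e^{l(x,y)} k₀(x;y) be an element of the exponential family E(k₀,L), and assume k' ∈ M_p(k,L). Then for every m ∈ M_p(k,L): ∑_{x,y} p(x) m(x;y) log( k'(x;y)/k₀(x;y) ) = ∑_{x,y} p(x) k'(x;y) log( k'(x;y)/k₀(x;y) ). -/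
open scoped ENNReal BigOperators

/-- The expectation of a function of the input alone does not depend on the channel. -/
theorem IsChannel.sum_mul_fst {X Y : Type} [Fintype X] [Fintype Y] {m : X × Y → ℝ}
    (hm : IsChannel m) (p f : X → ℝ) :
    ∑ z : X × Y, p z.1 * m z * f z.1 = ∑ x, p x * f x := by
  rw [Fintype.sum_prod_type]
  refine Finset.sum_congr rfl fun x _ => ?_
  dsimp only
  rw [← Finset.sum_mul, ← Finset.mul_sum, hm.2 x, mul_one]

/-- On the mixture family, the expectation of an element of `L` minus a function of the
input is constant. -/
theorem sum_mul_sub_fst_of_mem_mixFam {X Y : Type} [Fintype X] [Fintype Y]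
    {p : X → ℝ} {k m : X × Y → ℝ} {L : Submodule ℝ (X × Y → ℝ)} (hm : m ∈ mixFam p k L)
    {l : X × Y → ℝ} (hl : l ∈ L) (f : X → ℝ) :
    ∑ z : X × Y, p z.1 * m z * (l z - f z.1)
      = ∑ z : X × Y, p z.1 * k z * l z - ∑ x, p x * f x := by
  simp only [mul_sub, Finset.sum_sub_distrib]
  rw [hm.2 l hl, hm.1.sum_mul_fst p f]

/-- If `k' = e^l k₀ / Z` is an element of the exponential family `E(k₀,L)` that lies in
the mixture family `M_p(k,L)`, then for every `m ∈ M_p(k,L)` the `p`-weighted expectation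
of `log(k'/k₀)` under `m` equals the one under `k'`. -/
theorem expectation_log_ratio_const_on_mixFam
    {X Y : Type} [Fintype X] [Fintype Y] [Nonempty X] [Nonempty Y]
    (L : Submodule ℝ (X × Y → ℝ))
    (p : X → ℝ) (hp_pos : ∀ x, 0 < p x) (hp_sum : ∑ x, p x = 1)
    (k : X × Y → ℝ) (hk : IsChannel k)
    (k₀ : X × Y → ℝ) (hk₀ : IsChannel k₀) (hk₀_pos : ∀ z, 0 < k₀ z)
    (l : X × Y → ℝ) (hl : l ∈ L)
    (k' : X × Y → ℝ)
    (hk'_def : k' = fun z : X × Y =>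
      Real.exp (l z) * k₀ z / ∑ y : Y, Real.exp (l (z.1, y)) * k₀ (z.1, y))
    (hk'M : k' ∈ mixFam p k L) :
    ∀ m ∈ mixFam p k L,
      ∑ z : X × Y, p z.1 * m z * Real.log (k' z / k₀ z)
        = ∑ z : X × Y, p z.1 * k' z * Real.log (k' z / k₀ z) := by
  have hlog : ∀ z : X × Y, Real.log (k' z / k₀ z)
      = l z - Real.log (∑ y : Y, Real.exp (l (z.1, y)) * k₀ (z.1, y)) := by
    intro z
    have hZ : 0 < ∑ y : Y, Real.exp (l (z.1, y)) * k₀ (z.1, y) :=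
      Finset.sum_pos (fun y _ => mul_pos (Real.exp_pos _) (hk₀_pos _)) Finset.univ_nonempty
    rw [hk'_def]
    dsimp only
    rw [div_right_comm, mul_div_cancel_right₀ _ (hk₀_pos z).ne',
      Real.log_div (Real.exp_ne_zero _) hZ.ne', Real.log_exp]
  intro m hm
  simp only [hlog]
  let f : X → ℝ := fun x => Real.log (∑ y : Y, Real.exp (l (x, y)) * k₀ (x, y))
  exact (sum_mul_sub_fst_of_mem_mixFam hm hl f).trans
    (sum_mul_sub_fst_of_mem_mixFam hk'M hl f).symm
end
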